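/- arXiv:2405.10308 — 2 statements merged into one kernel-verified Lean document; each statement's English description precedes it below -/
import Mathlib

section
/- Let α be a finite type, ⊑ a preorder on α, and c : α → α a canonicalization with respect to the equivalence induced by ⊑. Let F ⊆ α be upward-closed with representation R_F = min {c(φ) | φ ∈ F}, and let P ⊆ α be upward-closed. For φ ∈ α define the weakening W(φ) = min {c(ψ) | φ ⊑ ψ and ψ ∈ P}. Then min (⋃_{φ ∈ R_F} W(φ)) = min {c(φ) | φ ∈ F ∩ P}; that is, weakening every formula of the representation of F by P and minimizing yields exactly the representation of F ∩ P. (Theorem 5, from weaken to join: taking P = {ψ | s ⊨ ψ} for a state s, this computes the representation of F ⊔ α({s}).) -/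
/-- The minimal elements of `S` with respect to the relation `r`:
those `φ ∈ S` such that no `ψ ∈ S` with `ψ ⊑ φ` and `ψ ≠ φ`. -/
def minWrt {α : Type*} (r : α → α → Prop) (S : Set α) : Set α :=
  {φ ∈ S | ∀ ψ ∈ S, r ψ φ → ψ = φ}

theorem minWrt_subset {α : Type*} (r : α → α → Prop) (S : Set α) : minWrt r S ⊆ S :=
  fun _ h => h.1

/-- In a finite set on which a preorder is antisymmetric, every element lies above
a minimal one. -/
theorem exists_mem_minWrt {α : Type*} {r : α → α → Prop}
    (hrefl : ∀ x, r x x) (htrans : ∀ x y z, r x y → r y z → r x z) {S : Set α}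
    (hfin : S.Finite) (hanti : ∀ x ∈ S, ∀ y ∈ S, r x y → r y x → x = y)
    {x : α} (hx : x ∈ S) : ∃ m ∈ minWrt r S, r m x := by
  let : Preorder α := { le := r, le_refl := hrefl, le_trans := htrans }
  obtain ⟨m, hmx, hm⟩ := hfin.exists_le_minimal hx
  exact ⟨m, ⟨hm.1, fun y hy hym => hanti y hy m hm.1 hym (hm.2 hy hym)⟩, hmx⟩

/-- Passing to a subset that is coinitial in `B` does not change the minimal elements. -/
theorem minWrt_eq_of_subset_of_coinitial {α : Type*} {r : α → α → Prop}
    (htrans : ∀ x y z, r x y → r y z → r x z) {A B : Set α} (hAB : A ⊆ B)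
    (hanti : ∀ x ∈ B, ∀ y ∈ B, r x y → r y x → x = y)
    (hco : ∀ b ∈ B, ∃ a ∈ A, r a b) : minWrt r A = minWrt r B := by
  apply Set.Subset.antisymm
  · rintro a ⟨ha, hmin⟩
    refine ⟨hAB ha, fun b hb hba => ?_⟩
    obtain ⟨a', ha', hab⟩ := hco b hb
    obtain rfl := hmin a' ha' (htrans _ _ _ hab hba)
    exact hanti b hb a' (hAB ha) hba hab
  · rintro b ⟨hb, hmin⟩
    obtain ⟨a, ha, hab⟩ := hco b hb
    obtain rfl := hmin a (hAB ha) hab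
    exact ⟨ha, fun x hx => hmin x (hAB hx)⟩

theorem weaken_to_join {α : Type*} [Fintype α] (r : α → α → Prop)
    (hrefl : Reflexive r) (htrans : Transitive r)
    (c : α → α)
    (hrep : ∀ φ, r (c φ) φ ∧ r φ (c φ))
    (hdec : ∀ φ ψ, (r φ ψ ∧ r ψ φ) ↔ c φ = c ψ)
    (F P : Set α)
    (hF : ∀ φ ψ, φ ∈ F → r φ ψ → ψ ∈ F)
    (hP : ∀ φ ψ, φ ∈ P → r φ ψ → ψ ∈ P) :
    minWrt r (⋃ φ ∈ minWrt r (c '' F), minWrt r (c '' {ψ | r φ ψ ∧ ψ ∈ P}))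
      = minWrt r (c '' (F ∩ P)) := by
  have htr : ∀ x y z, r x y → r y z → r x z := fun _ _ _ h h' => htrans h h'
  have hanti : ∀ G : Set α, ∀ x ∈ c '' G, ∀ y ∈ c '' G, r x y → r y x → x = y := by
    rintro G _ ⟨x, -, rfl⟩ _ ⟨y, -, rfl⟩ hxy hyx
    have hidem : ∀ z, c (c z) = c z := fun z => (hdec _ _).1 (hrep z)
    rw [← hidem x, ← hidem y]
    exact (hdec _ _).1 ⟨hxy, hyx⟩
  have hexists : ∀ (G : Set α), ∀ ψ ∈ G, ∃ m ∈ minWrt r (c '' G), r m (c ψ) :=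
    fun G ψ hψ => exists_mem_minWrt (fun x => hrefl x) htr (Set.toFinite _) (hanti G)
      (Set.mem_image_of_mem c hψ)
  apply minWrt_eq_of_subset_of_coinitial htr _ (hanti _)
  · rintro _ ⟨ψ, ⟨hψF, hψP⟩, rfl⟩
    obtain ⟨m, hm, hmψ⟩ := hexists F ψ hψF
    obtain ⟨a, ha, haψ⟩ :=
      hexists {χ | r m χ ∧ χ ∈ P} ψ ⟨htr _ _ _ hmψ (hrep ψ).1, hψP⟩
    exact ⟨a, Set.mem_biUnion hm ha, haψ⟩
  · refine Set.iUnion₂_subset fun φ hφ => (minWrt_subset r _).trans (Set.image_mono ?_)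
    rintro ψ ⟨hφψ, hψP⟩
    obtain ⟨χ, hχ, rfl⟩ := minWrt_subset r _ hφ
    exact ⟨hF _ _ hχ (htr _ _ _ (hrep χ).2 hφψ), hψP⟩
end

section
/- Let α be a finite partially ordered type with order ⊑, let P ⊆ α be upward-closed, and let k be a natural number. For finite multisets A, B over α write A ⊑∨ B iff there is a sub-multiset B' of B and a bijective pairing of A with B' matching each element a of A to an element b of B' with a ⊑ b. Let A be a multiset with |A| ≤ k such that no element of A lies in P. Define W₁ = {(A with one occurrence of a removed) + {a'} | a ∈ A, a' minimal in {p ∈ P | a ⊑ p}}, and W₂ = {A + {p} | p minimal in P} if |A| < k and W₂ = ∅ otherwise. Then the set of ⊑∨-minimal elements of {B | |B| ≤ k, A ⊑∨ B, and some element of B lies in P} equals the set of ⊑∨-minimal elements of W₁ ∪ W₂. (This is the homogeneous-disjunction case of Theorem 4: a disjunction of at most k disjuncts, none satisfied by the state, is minimally weakened either by minimally weakening exactly one existing disjunct or, if there is room, by adding a minimal new disjunct.) -/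
/-- The minimal elements of a subset of a partially ordered type. -/
def minSet {α : Type*} [PartialOrder α] (S : Set α) : Set α :=
  {x ∈ S | ∀ y ∈ S, y ≤ x → y = x}

/-- Disjunction-subsumption on multisets: `A ⊑∨ B` iff there is a sub-multiset `B'` of `B`
and a bijective pairing of `A` with `B'` matching each `a ∈ A` with some `b ∈ B'`, `a ≤ b`. -/
def MSubOr {α : Type*} [Preorder α] (A B : Multiset α) : Prop :=
  ∃ B' ≤ B, Multiset.Rel (· ≤ ·) A B'

/-- The `⊑∨`-minimal elements of a set of multisets. -/
def minOr {α : Type*} [Preorder α] (S : Set (Multiset α)) : Set (Multiset α) :=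
  {B ∈ S | ∀ B' ∈ S, MSubOr B' B → B' = B}

namespace MSubOr

theorem refl {α : Type*} [Preorder α] (A : Multiset α) : MSubOr A A :=
  ⟨A, le_rfl, Multiset.rel_refl_of_refl_on fun _ _ => le_rfl⟩

theorem cons {α : Type*} [Preorder α] {A B : Multiset α} {a b : α} (hab : a ≤ b)
    (h : MSubOr A B) : MSubOr (a ::ₘ A) (b ::ₘ B) := by
  obtain ⟨B', hB', hrel⟩ := h
  exact ⟨b ::ₘ B', Multiset.cons_le_cons b hB', hrel.cons hab⟩

theorem trans_le {α : Type*} [Preorder α] {A B C : Multiset α} (h : MSubOr A B)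
    (hBC : B ≤ C) : MSubOr A C := by
  obtain ⟨B', hB', hrel⟩ := h
  exact ⟨B', hB'.trans hBC, hrel⟩

theorem trans {α : Type*} [Preorder α] {A B C : Multiset α} (hAB : MSubOr A B)
    (hBC : MSubOr B C) : MSubOr A C := by
  obtain ⟨B', hB', hAB'⟩ := hAB
  obtain ⟨C', hC', hBC'⟩ := hBC
  obtain ⟨D, rfl⟩ := Multiset.le_iff_exists_add.1 hB'
  obtain ⟨C₁, C₂, h₁, -, rfl⟩ := Multiset.rel_add_left.1 hBC'
  exact ⟨C₁, (Multiset.le_add_right _ _).trans hC', hAB'.trans _ h₁⟩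

open Classical in
theorem countP_le {α : Type*} [Preorder α] {A B : Multiset α} (h : MSubOr A B)
    {U : α → Prop} (hU : ∀ a b, U a → a ≤ b → U b) :
    A.countP U ≤ B.countP U := by
  obtain ⟨B', hB', hrel⟩ := h
  refine le_trans ?_ (Multiset.countP_le_of_le _ hB')
  clear hB'
  induction hrel with
  | zero => simp
  | @cons a b A B hab _ ih =>
    have := hU a b
    simp only [Multiset.countP_cons]
    split_ifs <;> first | omega | tauto

open Classical in
theorem antisymm {α : Type*} [PartialOrder α] {A B : Multiset α} (hAB : MSubOr A B)
    (hBA : MSubOr B A) : A = B := by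
  have hcount (U : α → Prop) (hU : ∀ a b, U a → a ≤ b → U b) : A.countP U = B.countP U :=
    le_antisymm (hAB.countP_le hU) (hBA.countP_le hU)
  have hsplit (x : α) (C : Multiset α) :
      C.countP (x ≤ ·) = C.count x + C.countP (x < ·) := by
    induction C using Multiset.induction with
    | empty => simp
    | cons c C ih =>
      have h₁ : x ≤ c ↔ x = c ∨ x < c := le_iff_eq_or_lt
      have h₂ : x = c → ¬ x < c := fun h => h.not_lt
      simp only [Multiset.countP_cons, Multiset.count_cons]
      split_ifs <;> first | omega | tauto
  ext x
  have h₁ := hcount (x ≤ ·) fun _ _ => le_trans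
  have h₂ := hcount (x < ·) fun _ _ => lt_of_lt_of_le
  rw [hsplit, hsplit] at h₁
  omega

end MSubOr

theorem exists_mem_minSet_le {α : Type*} [PartialOrder α] [Finite α] {S : Set α} {b : α}
    (hb : b ∈ S) : ∃ m ∈ minSet S, m ≤ b := by
  obtain ⟨m, hmb, hm⟩ := S.toFinite.exists_le_minimal hb
  exact ⟨m, ⟨hm.prop, fun y hy hym => hym.antisymm (hm.le_of_le hy hym)⟩, hmb⟩

/-- A subset that is coinitial for `⊑∨` has the same `⊑∨`-minimal elements. -/
theorem minOr_eq_of_subset {α : Type*} [PartialOrder α] {S W : Set (Multiset α)}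
    (hWS : W ⊆ S) (h : ∀ B ∈ S, ∃ w ∈ W, MSubOr w B) : minOr S = minOr W := by
  ext B
  constructor
  · rintro ⟨hB, hmin⟩
    obtain ⟨w, hw, hwB⟩ := h B hB
    obtain rfl := hmin w (hWS hw) hwB
    exact ⟨hw, fun B' hB' => hmin B' (hWS hB')⟩
  · rintro ⟨hB, hmin⟩
    refine ⟨hWS hB, fun B' hB' hle => ?_⟩
    obtain ⟨w, hw, hwB'⟩ := h B' hB'
    obtain rfl := hmin w hw (hwB'.trans hle)
    exact hle.antisymm hwB'

theorem weaken_homogeneous_or {α : Type*} [PartialOrder α] [Fintype α] [DecidableEq α]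
    (P : Set α) (hP : ∀ a b : α, a ∈ P → a ≤ b → b ∈ P)
    (k : ℕ) (A : Multiset α) (hcard : Multiset.card A ≤ k) (hA : ∀ a ∈ A, a ∉ P) :
    minOr {B : Multiset α | Multiset.card B ≤ k ∧ MSubOr A B ∧ ∃ b ∈ B, b ∈ P}
      = minOr
          ({B : Multiset α | ∃ a ∈ A, ∃ a' ∈ minSet {p | p ∈ P ∧ a ≤ p},
              B = a' ::ₘ A.erase a}
            ∪ if Multiset.card A < k then
                {B : Multiset α | ∃ p ∈ minSet P, B = p ::ₘ A}
              else ∅) := by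
  apply minOr_eq_of_subset
  · rintro B (⟨a, ha, a', ⟨⟨haP, haa'⟩, -⟩, rfl⟩ | hB)
    · refine ⟨?_, ?_, a', Multiset.mem_cons_self _ _, haP⟩
      · rwa [Multiset.card_cons, Multiset.card_erase_add_one ha]
      · have h := (MSubOr.refl (A.erase a)).cons haa'
        rwa [Multiset.cons_erase ha] at h
    · split_ifs at hB with hlt
      · obtain ⟨p, ⟨hp, -⟩, rfl⟩ := hB
        refine ⟨?_, (MSubOr.refl A).trans_le (Multiset.le_cons_self _ _), p,
          Multiset.mem_cons_self _ _, hp⟩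
        rw [Multiset.card_cons]
        exact hlt
      · exact hB.elim
  · rintro B ⟨hBk, ⟨B', hB', hrel⟩, b, hb, hbP⟩
    obtain ⟨D, rfl⟩ := Multiset.le_iff_exists_add.1 hB'
    rcases Multiset.mem_add.1 hb with hbB' | hbD
    · obtain ⟨C, rfl⟩ := Multiset.exists_cons_of_mem hbB'
      obtain ⟨a, A', hab, hA', rfl⟩ := Multiset.rel_cons_right.1 hrel
      obtain ⟨m, hm, hmb⟩ := exists_mem_minSet_le (S := {p | p ∈ P ∧ a ≤ p}) ⟨hbP, hab⟩
      refine ⟨_, Or.inl ⟨a, Multiset.mem_cons_self _ _, m, hm, rfl⟩, ?_⟩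
      rw [Multiset.erase_cons_head]
      exact ⟨b ::ₘ C, hB', hA'.cons hmb⟩
    · obtain ⟨C, rfl⟩ := Multiset.exists_cons_of_mem hbD
      obtain ⟨m, hm, hmb⟩ := exists_mem_minSet_le hbP
      have hlt : Multiset.card A < k := by
        have := Multiset.card_eq_card_of_rel hrel
        simp only [Multiset.card_add, Multiset.card_cons] at hBk
        omega
      refine ⟨m ::ₘ A, Or.inr ?_, ?_⟩
      · rw [if_pos hlt]
        exact ⟨m, hm, rfl⟩
      · rw [Multiset.add_cons]
        exact MSubOr.cons hmb ⟨B', Multiset.le_add_right _ _, hrel⟩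
end
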